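/- Let X and Y be real Hilbert spaces and Ã : X → Y a bounded linear operator. For each L ∈ [0,1) let f_L : X → X be Lipschitz continuous with Lipschitz constant at most L and set φ_L(x) = x − f_L(x). Let x₁†, x₂† ∈ X satisfy Ã x₁† = Ã x₂†. Suppose each x_k† (k = 1,2) fulfills the local approximation property: there exist an index function ψ_k, a constant C_k > 0 and L_k ∈ [0,1) such that ‖Ã*Ã x_k† − φ_L(x_k†)‖ ≤ C_k (1−L) ψ_k(1−L) for all L ∈ [L_k, 1). Then x₁† = x₂†. -/

import Mathlib

/-- An index function is continuous, strictly increasing on `[0,∞)`, nonnegative,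
and vanishes at `0`. -/
def IsIndexFunction (ψ : ℝ → ℝ) : Prop :=
  ContinuousOn ψ (Set.Ici 0) ∧ StrictMonoOn ψ (Set.Ici 0) ∧ ψ 0 = 0 ∧
    ∀ t ∈ Set.Ici (0 : ℝ), 0 ≤ ψ t

/-- The values of an index function tend to `0` as the Lipschitz constant tends to `1`. -/
theorem IsIndexFunction.tendsto_one_sub {ψ : ℝ → ℝ} (hψ : IsIndexFunction ψ) :
    Filter.Tendsto (fun L : ℝ => ψ (1 - L)) (nhdsWithin 1 (Set.Iio 1)) (nhds 0) := by
  obtain ⟨hcont, -, hzero, -⟩ := hψ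
  have hψ0 : Filter.Tendsto ψ (nhdsWithin 0 (Set.Ici 0)) (nhds 0) := by
    simpa only [hzero] using (hcont 0 Set.self_mem_Ici).tendsto
  refine hψ0.comp (tendsto_nhdsWithin_iff.2 ⟨?_, ?_⟩)
  · have h : Filter.Tendsto (fun L : ℝ => 1 - L) (nhds 1) (nhds (1 - 1)) :=
      (continuous_const.sub continuous_id).tendsto 1
    rw [sub_self] at h
    exact h.mono_left nhdsWithin_le_nhds
  · filter_upwards [self_mem_nhdsWithin] with L hL
    exact sub_nonneg.2 (Set.mem_Iio.1 hL).le

/-- A residual map `x ↦ x - g x` with `g` Lipschitz of constant `L` expands distances by at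
least `1 - L`, here tested against approximate values at a common point `z`. -/
theorem one_sub_mul_norm_sub_le {X : Type*} [NormedAddCommGroup X] {g : X → X} {L : ℝ}
    {x y : X} (hg : ‖g x - g y‖ ≤ L * ‖x - y‖) (z : X) :
    (1 - L) * ‖x - y‖ ≤ ‖z - (x - g x)‖ + ‖z - (y - g y)‖ := by
  have hsplit : x - y = (z - (y - g y)) - (z - (x - g x)) + (g x - g y) := by abel
  have h : ‖x - y‖ ≤ ‖z - (y - g y)‖ + ‖z - (x - g x)‖ + ‖g x - g y‖ :=
    calc ‖x - y‖ = ‖(z - (y - g y)) - (z - (x - g x)) + (g x - g y)‖ := congrArg _ hsplit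
      _ ≤ _ := (norm_add_le _ _).trans (by gcongr; exact norm_sub_le _ _)
  linarith

/-- Two solutions of `Ã x = y` which both fulfill the local approximation property
must coincide. -/
theorem local_approx_unique_solution
    {X Y : Type*} [NormedAddCommGroup X] [InnerProductSpace ℝ X] [CompleteSpace X]
    [NormedAddCommGroup Y] [InnerProductSpace ℝ Y] [CompleteSpace Y]
    (A : X →L[ℝ] Y)
    (f : ℝ → X → X)
    (hf : ∀ L ∈ Set.Ico (0 : ℝ) 1, ∀ x y : X, ‖f L x - f L y‖ ≤ L * ‖x - y‖)
    (x₁ x₂ : X) (hAx : A x₁ = A x₂)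
    (h₁ : ∃ ψ : ℝ → ℝ, IsIndexFunction ψ ∧ ∃ C > (0 : ℝ), ∃ L₁ ∈ Set.Ico (0 : ℝ) 1,
      ∀ L ∈ Set.Ico L₁ 1,
        ‖ContinuousLinearMap.adjoint A (A x₁) - (x₁ - f L x₁)‖ ≤ C * (1 - L) * ψ (1 - L))
    (h₂ : ∃ ψ : ℝ → ℝ, IsIndexFunction ψ ∧ ∃ C > (0 : ℝ), ∃ L₂ ∈ Set.Ico (0 : ℝ) 1,
      ∀ L ∈ Set.Ico L₂ 1,
        ‖ContinuousLinearMap.adjoint A (A x₂) - (x₂ - f L x₂)‖ ≤ C * (1 - L) * ψ (1 - L)) :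
    x₁ = x₂ := by
  obtain ⟨ψ₁, hψ₁, C₁, -, L₁, hL₁, h₁⟩ := h₁
  obtain ⟨ψ₂, hψ₂, C₂, -, L₂, hL₂, h₂⟩ := h₂
  have hlim : Filter.Tendsto (fun L : ℝ => C₁ * ψ₁ (1 - L) + C₂ * ψ₂ (1 - L))
      (nhdsWithin 1 (Set.Iio 1)) (nhds 0) := by
    simpa using (hψ₁.tendsto_one_sub.const_mul C₁).add (hψ₂.tendsto_one_sub.const_mul C₂)
  have hle : ‖x₁ - x₂‖ ≤ 0 := by
    refine ge_of_tendsto hlim ?_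
    filter_upwards [Ico_mem_nhdsLT hL₁.2, Ico_mem_nhdsLT hL₂.2] with L hm₁ hm₂
    have hmain := one_sub_mul_norm_sub_le (hf L ⟨hL₁.1.trans hm₁.1, hm₁.2⟩ x₁ x₂)
      (ContinuousLinearMap.adjoint A (A x₁))
    have hb₁ := h₁ L hm₁
    have hb₂ := h₂ L hm₂
    rw [← hAx] at hb₂
    refine le_of_mul_le_mul_left ?_ (sub_pos.2 hm₁.2)
    linarith
  exact sub_eq_zero.1 (norm_le_zero_iff.1 hle)
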